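/- arXiv:1901.05080 — 5 statements merged into one kernel-verified Lean document; each statement's English description precedes it below -/
import Mathlib

section
/- Let q be a polynomial with integer coefficients of degree at least 1. Then the set of prime numbers p such that p divides q(n) for some positive integer n is infinite. -/
theorem fin_aux (q : Polynomial ℤ) (hq : 1 ≤ q.natDegree) (c : ℤ) :
    {n : ℕ | q.eval (n : ℤ) = c}.Finite := by
  have h0 : q - Polynomial.C c ≠ 0 := by
    intro h
    rw [sub_eq_zero] at h
    rw [h, Polynomial.natDegree_C] at hq
    omega
  have h1 : {x : ℤ | (q - Polynomial.C c).IsRoot x}.Finite :=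
    Polynomial.finite_setOf_isRoot h0
  refine (h1.preimage (f := fun n : ℕ => (n : ℤ)) Nat.cast_injective.injOn).subset ?_
  intro n hn
  have hn' : q.eval (n : ℤ) = c := hn
  simp [hn']

theorem stmt_7 (q : Polynomial ℤ) (hq : 1 ≤ q.natDegree) :
    {p : ℕ | p.Prime ∧ ∃ n : ℕ, 0 < n ∧ (p : ℤ) ∣ q.eval (n : ℤ)}.Infinite := by
  intro hfin
  obtain ⟨n0, hn0⟩ := ((fin_aux q hq 0).union (Set.finite_singleton 0)).exists_notMem
  simp only [Set.mem_union, Set.mem_setOf_eq, Set.mem_singleton_iff, not_or] at hn0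
  obtain ⟨ha, hpos⟩ := hn0
  set a := q.eval (n0 : ℤ) with hadef
  set P : ℕ := ∏ p ∈ hfin.toFinset, p with hP
  have hP0 : P ≠ 0 := by
    rw [hP, Finset.prod_ne_zero_iff]
    intro p hp
    exact ((hfin.mem_toFinset.mp hp).1).ne_zero
  have hinj : Function.Injective (fun t : ℕ => n0 + a.natAbs * P * t) := by
    intro s t h
    have h' : a.natAbs * P * s = a.natAbs * P * t := Nat.add_left_cancel h
    exact Nat.eq_of_mul_eq_mul_left
      (Nat.pos_of_ne_zero (mul_ne_zero (Int.natAbs_ne_zero.mpr ha) hP0)) h'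
  obtain ⟨t, ht⟩ := (((fin_aux q hq a).union (fin_aux q hq (-a))).preimage
    hinj.injOn).exists_notMem
  simp only [Set.mem_preimage, Set.mem_union, Set.mem_setOf_eq, not_or] at ht
  set n := n0 + a.natAbs * P * t with hn
  have hd : a * P ∣ q.eval (n : ℤ) - a := by
    refine dvd_trans ?_ (Polynomial.sub_dvd_eval_sub (n : ℤ) (n0 : ℤ) q)
    have : (n : ℤ) - n0 = |a| * P * t := by rw [hn]; push_cast; ring
    rw [this]
    exact Dvd.dvd.mul_right (mul_dvd_mul_right ((dvd_abs a a).mpr dvd_rfl) _) _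
  obtain ⟨k, hk⟩ := hd
  have hqn : q.eval (n : ℤ) = a * (1 + P * k) := by linarith
  have hne : (1 + (P : ℤ) * k).natAbs ≠ 1 := by
    intro h
    rcases Int.natAbs_eq_iff.mp h with h | h
    · exact ht.1 (by rw [hqn, h]; simp)
    · exact ht.2 (by rw [hqn, h]; simp)
  obtain ⟨p, hp, hpd⟩ := Nat.exists_prime_and_dvd hne
  have hpd' : (p : ℤ) ∣ 1 + P * k := Int.natCast_dvd.mpr hpd
  have hmem : p ∈ hfin.toFinset := by
    rw [hfin.mem_toFinset]
    exact ⟨hp, n, by omega, hqn ▸ hpd'.mul_left a⟩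
  have hpP : (p : ℤ) ∣ P := Int.natCast_dvd_natCast.mpr (Finset.dvd_prod_of_mem _ hmem)
  have h1 : (p : ℤ) ∣ 1 := (dvd_add_left (hpP.mul_right k)).mp hpd'
  exact hp.one_lt.ne' (by exact_mod_cast Nat.dvd_one.mp (by exact_mod_cast h1))
end

section
/- Let F be an ultrafilter on a type ι and let K be an algebraically closed field. Then the ultrapower field Filter.Germ ↑F K (the quotient of the product ∏_{i∈ι} K by equality F-almost everywhere, with its induced field structure) is algebraically closed. -/
theorem stmt_10 {ι : Type*} (F : Ultrafilter ι) (K : Type*) [Field K] [IsAlgClosed K] :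
    IsAlgClosed (Filter.Germ (↑F : Filter ι) K) := by
  apply IsAlgClosed.of_exists_root
  intro p hm hp
  let φ : (ι → K) →+* Filter.Germ (↑F : Filter ι) K := Filter.Germ.coeRingHom (↑F : Filter ι)
  have hφ : Function.Surjective φ := fun g => Filter.Germ.inductionOn g fun f => ⟨f, rfl⟩
  have hl : p ∈ Polynomial.lifts φ :=
    (Polynomial.mem_lifts p).2 (Polynomial.map_surjective φ hφ p)
  obtain ⟨q, hq, hd, hqm⟩ := Polynomial.lifts_and_natDegree_eq_and_monic hl hm
  have hx : ∀ i, ∃ x : K, (q.map (Pi.evalRingHom (fun _ : ι => K) i)).eval x = 0 := by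
    intro i
    apply IsAlgClosed.exists_root
    have h1 := hqm.natDegree_map (Pi.evalRingHom (fun _ : ι => K) i)
    have h2 := hp.natDegree_pos
    refine Polynomial.degree_ne_of_natDegree_ne (n := 0) ?_
    omega
  choose x hx using hx
  have h0 : q.eval x = 0 := by
    funext i
    have h := hx i
    have h' := Polynomial.eval_map_apply (p := q) (f := Pi.evalRingHom (fun _ : ι => K) i) x
    exact h'.symm.trans h
  refine ⟨φ x, ?_⟩
  rw [← hq, Polynomial.eval_map_apply, h0, map_zero]
end

section
/- Let F be a nonprincipal ultrafilter on ℕ. Then the cardinality of the ultrapower field Filter.Germ ↑F (algebraic closure of ℚ) is exactly the continuum 2^{ℵ₀}. -/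
theorem card_algClosure_le (k : Type) [Field k] :
    Cardinal.mk (AlgebraicClosure k) ≤ max (Cardinal.mk k) Cardinal.aleph0 :=
  Algebra.IsAlgebraic.cardinalMk_le_max k (AlgebraicClosure k)

theorem stmt_11 (F : Ultrafilter ℕ) (hF : ∀ a : ℕ, F ≠ pure a) :
    Cardinal.mk (Filter.Germ (↑F : Filter ℕ) (AlgebraicClosure ℚ)) = Cardinal.continuum := by
  apply le_antisymm
  · have h1 : Cardinal.mk (Filter.Germ (↑F : Filter ℕ) (AlgebraicClosure ℚ))
        ≤ Cardinal.mk (ℕ → AlgebraicClosure ℚ) := by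
      apply Cardinal.mk_le_of_surjective
        (f := fun f : ℕ → AlgebraicClosure ℚ => (f : Filter.Germ (↑F : Filter ℕ) _))
      intro x
      induction x using Filter.Germ.inductionOn with
      | _ f => exact ⟨f, rfl⟩
    refine h1.trans ?_
    have h2 : Cardinal.mk (AlgebraicClosure ℚ) ≤ Cardinal.aleph0 := by
      have := card_algClosure_le ℚ
      simpa using this
    have h3 : Cardinal.mk (ℕ → AlgebraicClosure ℚ)
        = Cardinal.mk (AlgebraicClosure ℚ) ^ Cardinal.aleph0 := by
      simp
    rw [h3, ← Cardinal.aleph0_power_aleph0]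
    exact Cardinal.power_le_power_right h2
  · have hc : (F : Filter ℕ) ≤ Filter.cofinite := by
      rcases F.le_cofinite_or_eq_pure with h | ⟨a, h⟩
      · exact h
      · exact absurd h (hF a)
    have hB : Cardinal.mk (ℕ → Bool) = Cardinal.continuum := by simp
    rw [← hB]
    let φ : (ℕ → Bool) → ℕ → AlgebraicClosure ℚ := fun f n =>
      ((Encodable.encode ((List.range n).map f) : ℕ) : AlgebraicClosure ℚ)
    apply Cardinal.mk_le_of_injective
      (f := fun f => ((φ f : ℕ → AlgebraicClosure ℚ) : Filter.Germ (↑F : Filter ℕ) _))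
    intro f g hfg
    have he : ∀ᶠ n in (F : Filter ℕ), φ f n = φ g n := Filter.Germ.coe_eq.mp hfg
    funext k
    have hk : ∀ᶠ n in (F : Filter ℕ), k < n := by
      apply hc
      rw [Nat.cofinite_eq_atTop]
      exact Filter.eventually_gt_atTop k
    obtain ⟨n, hn, hkn⟩ := (he.and hk).exists
    have h4 := Encodable.encode_injective (Nat.cast_injective hn)
    exact List.map_inj_left.mp h4 k (List.mem_range.mpr hkn)
end

section
/- Let F be a nonprincipal ultrafilter on ℕ. Then the ultrapower field Filter.Germ ↑F (algebraic closure of ℚ) is isomorphic as a ring (hence as a field) to the field ℂ of complex numbers. -/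
theorem aux_algClosed (F : Ultrafilter ℕ) (K : Type) [Field K] [IsAlgClosed K] :
    IsAlgClosed (Filter.Germ (↑F : Filter ℕ) K) := by
  apply IsAlgClosed.of_exists_root
  intro p hp hirr
  have hd : 0 < p.natDegree := hirr.natDegree_pos
  have hc : ∀ i, ∃ c : ℕ → K, (Filter.Germ.coeRingHom (↑F : Filter ℕ) c) = p.coeff i := by
    intro i
    induction p.coeff i using Filter.Germ.inductionOn with
    | _ f => exact ⟨f, rfl⟩
  choose c hc using hc
  have hr : ∀ n, ∃ x : K, x ^ p.natDegree
      + ∑ i ∈ Finset.range p.natDegree, c i n * x ^ i = 0 := by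
    intro n
    let s : Polynomial K := ∑ i ∈ Finset.range p.natDegree,
      Polynomial.C (c i n) * Polynomial.X ^ i
    have hs : s.degree < (p.natDegree : WithBot ℕ) := by
      refine (Polynomial.degree_sum_le _ _).trans_lt ?_
      rw [Finset.sup_lt_iff (WithBot.bot_lt_coe _)]
      intro i hi
      refine (Polynomial.degree_C_mul_X_pow_le _ _).trans_lt ?_
      exact_mod_cast Finset.mem_range.1 hi
    have hdeg : (Polynomial.X ^ p.natDegree + s).degree = (p.natDegree : WithBot ℕ) := by
      rw [Polynomial.degree_add_eq_left_of_degree_lt] <;> simp [hs]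
    obtain ⟨x, hx⟩ := IsAlgClosed.exists_root (Polynomial.X ^ p.natDegree + s) (by
      rw [hdeg]; exact_mod_cast hd.ne')
    refine ⟨x, ?_⟩
    simpa [s, Polynomial.IsRoot, Polynomial.eval_finsetSum] using hx
  choose r hr using hr
  refine ⟨Filter.Germ.coeRingHom (↑F : Filter ℕ) r, ?_⟩
  rw [Polynomial.eval_eq_sum_range, Finset.sum_range_succ, hp.coeff_natDegree, one_mul, add_comm]
  simp_rw [← hc, ← map_pow, ← map_mul]
  rw [← map_sum, ← map_add, ← map_zero (Filter.Germ.coeRingHom (↑F : Filter ℕ))]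
  congr 1
  ext n
  simpa using hr n

theorem aux_card (F : Ultrafilter ℕ) (hF : ∀ a : ℕ, F ≠ pure a) (K : Type) [Field K] [CharZero K]
    (hK : Cardinal.mk K ≤ Cardinal.aleph0) :
    Cardinal.mk (Filter.Germ (↑F : Filter ℕ) K) = Cardinal.continuum := by
  apply le_antisymm
  · have h1 : Cardinal.mk (Filter.Germ (↑F : Filter ℕ) K) ≤ Cardinal.mk (ℕ → K) :=
      Cardinal.mk_le_of_surjective (f := fun f : ℕ → K => (f : Filter.Germ (↑F : Filter ℕ) K))
        (fun x => by
          induction x using Filter.Germ.inductionOn with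
          | _ f => exact ⟨f, rfl⟩)
    refine h1.trans ?_
    rw [← Cardinal.power_def, Cardinal.mk_nat]
    exact (Cardinal.power_le_power_right hK).trans Cardinal.aleph0_power_aleph0.le
  · classical
    rw [← Cardinal.two_power_aleph0, ← Cardinal.mk_nat, ← Cardinal.mk_set]
    refine Cardinal.mk_le_of_injective (f := fun S : Set ℕ =>
      ((fun n => ((Encodable.encode ((Finset.range n).filter (· ∈ S)) : ℕ) : K)) :
        Filter.Germ (↑F : Filter ℕ) K)) ?_
    intro S T hST
    have h := Filter.Germ.coe_eq.1 hST
    have hcof : (↑F : Filter ℕ) ≤ Filter.cofinite := by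
      rcases F.le_cofinite_or_eq_pure with h | ⟨a, ha⟩
      · exact h
      · exact absurd ha (hF a)
    ext i
    have hi : ∀ᶠ n in (↑F : Filter ℕ), i < n := by
      apply hcof
      rw [Nat.cofinite_eq_atTop]
      exact Filter.eventually_gt_atTop i
    obtain ⟨n, hn, hin⟩ := (h.and hi).exists
    have h2 := Encodable.encode_injective (Nat.cast_injective hn)
    have h3 := Finset.ext_iff.1 h2 i
    simpa [hin] using h3

theorem stmt_12 (F : Ultrafilter ℕ) (hF : ∀ a : ℕ, F ≠ pure a) :
    Nonempty (Filter.Germ (↑F : Filter ℕ) (AlgebraicClosure ℚ) ≃+* ℂ) := by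
  have hK : Cardinal.mk (AlgebraicClosure ℚ) ≤ Cardinal.aleph0 := by
    have : Algebra.IsAlgebraic ℚ (AlgebraicClosure ℚ) := by
      have e : (DivisionRing.toRatAlgebra : Algebra ℚ (AlgebraicClosure ℚ)) =
        AlgebraicClosure.instAlgebra ℚ := Subsingleton.elim _ _
      rw [e]
      exact AlgebraicClosure.isAlgebraic ℚ
    simpa using Algebra.IsAlgebraic.cardinalMk_le_max ℚ (AlgebraicClosure ℚ)
  have hcard := aux_card F hF (AlgebraicClosure ℚ) hK
  have := aux_algClosed F (AlgebraicClosure ℚ)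
  have : CharZero (Filter.Germ (↑F : Filter ℕ) (AlgebraicClosure ℚ)) :=
    charZero_of_injective_ringHom ((Filter.Germ.coeRingHom (↑F : Filter ℕ)).comp
      (Pi.constRingHom ℕ (AlgebraicClosure ℚ))).injective
  refine IsAlgClosed.ringEquiv_of_equiv_of_charZero ?_ ?_
  · rw [hcard]; exact Cardinal.aleph0_lt_continuum
  · exact Cardinal.eq.1 (hcard.trans Cardinal.mk_complex.symm)
end

section
/- Let F be a nonprincipal ultrafilter on ℕ, and let x be the element of the ultrapower field Filter.Germ ↑F (algebraic closure of ℚ) represented by the sequence n ↦ (n : algebraic closure of ℚ). Then x is transcendental over ℚ; that is, x is not a root of any nonzero polynomial with rational coefficients. -/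
instance germCharZero (F : Ultrafilter ℕ) :
    CharZero (Filter.Germ (↑F : Filter ℕ) (AlgebraicClosure ℚ)) := by
  constructor
  intro a b h
  have ha : ((a : AlgebraicClosure ℚ) : Filter.Germ (↑F : Filter ℕ) (AlgebraicClosure ℚ)) =
      ((b : AlgebraicClosure ℚ) : Filter.Germ (↑F : Filter ℕ) (AlgebraicClosure ℚ)) := by
    rw [Filter.Germ.const_nat, Filter.Germ.const_nat, h]
  exact Nat.cast_injective (Filter.Germ.const_inj.mp ha)

theorem stmt_13 (F : Ultrafilter ℕ) (hF : ∀ a : ℕ, F ≠ pure a) :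
    Transcendental ℚ
      ((↑(fun n : ℕ => (n : AlgebraicClosure ℚ)) :
        Filter.Germ (↑F : Filter ℕ) (AlgebraicClosure ℚ))) := by
  rw [transcendental_iff]
  intro p hp
  by_contra hp0
  let φ : (ℕ → AlgebraicClosure ℚ) →+* Filter.Germ (↑F : Filter ℕ) (AlgebraicClosure ℚ) :=
    Filter.Germ.coeRingHom (↑F : Filter ℕ)
  let f : ℕ → AlgebraicClosure ℚ := fun n => (n : AlgebraicClosure ℚ)
  have h1 : Polynomial.aeval (φ.toRatAlgHom f) p = 0 := hp
  rw [Polynomial.aeval_algHom_apply] at h1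
  have h2 : ((Polynomial.aeval f p : ℕ → AlgebraicClosure ℚ) :
      Filter.Germ (↑F : Filter ℕ) (AlgebraicClosure ℚ)) =
      ((fun _ => 0 : ℕ → AlgebraicClosure ℚ) :
        Filter.Germ (↑F : Filter ℕ) (AlgebraicClosure ℚ)) := h1
  have h3 : {n : ℕ | Polynomial.aeval f p n = 0} ∈ F := Filter.Germ.coe_eq.mp h2
  have hfin : {n : ℕ | Polynomial.aeval f p n = 0}.Finite := by
    have h4 := p.rootSet_finite (AlgebraicClosure ℚ)
    refine (h4.preimage (f := f) (Nat.cast_injective.injOn)).subset ?_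
    intro n hn
    rw [Set.mem_preimage, Polynomial.mem_rootSet]
    refine ⟨hp0, ?_⟩
    have h5 := Polynomial.aeval_algHom_apply
      (Pi.evalAlgHom ℚ (fun _ : ℕ => AlgebraicClosure ℚ) n) f p
    exact h5.trans hn
  obtain ⟨a, _, ha⟩ := Ultrafilter.eq_pure_of_finite_mem hfin h3
  exact hF a ha
end
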